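/- Let C_d^+ = {P ∈ ℝ^{d+1} : P·P = 0, P₀ > 0} be the future lightcone with Minkowski product P·Q = P₀Q₀ - P₁Q₁ - … - P_dQ_d, and let f : C_d^+ → ℂ be smooth and homogeneous of degree -(d-1), i.e. f(λP) = λ^{-(d-1)} f(P) for all λ > 0. Let ω = i_ξ μ where μ = (dP₁ ∧ … ∧ dP_d)/P₀ and ξ is the Euler (dilation) vector field. Then the (d-1)-form f·ω on C_d^+ is closed: d(f ω) = 0. -/

import Mathlib

/-- Euler's identity in divergence form: if `H` is homogeneous of degree `-d` along the ray through
`q`, then the field `x ↦ H x • x` on `ℝ^d` has zero divergence at `q`. -/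
theorem sum_fderiv_mul_coord_eq_zero_of_homogeneous {d : ℕ} {H : (Fin d → ℝ) → ℂ} {q : Fin d → ℝ}
    (hH : DifferentiableAt ℝ H q)
    (hhom : ∀ t : ℝ, 0 < t → H (t • q) = ((t ^ d)⁻¹ : ℝ) • H q) :
    ∑ k : Fin d, fderiv ℝ (fun x : Fin d → ℝ => H x * (x k : ℂ)) q (Pi.single k 1) = 0 := by
  have euler : fderiv ℝ H q q = -(d : ℂ) * H q := by
    have hray : HasDerivAt (fun t : ℝ => t • q) q 1 := by
      simpa using (hasDerivAt_id (1 : ℝ)).smul_const q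
    have hH' : HasFDerivAt H (fderiv ℝ H q) ((1 : ℝ) • q) := by
      simpa using hH.hasFDerivAt
    have h₁ : HasDerivAt (fun t : ℝ => H (t • q)) (fderiv ℝ H q q) 1 :=
      hH'.comp_hasDerivAt 1 hray
    have h₂ : HasDerivAt (fun t : ℝ => ((t ^ d)⁻¹ : ℝ) • H q) ((-(d : ℝ)) • H q) 1 := by
      have h := ((hasDerivAt_pow d (1 : ℝ)).fun_inv (by simp)).smul_const (H q)
      simpa using h
    have h₃ : (fun t : ℝ => H (t • q)) =ᶠ[nhds 1] fun t : ℝ => ((t ^ d)⁻¹ : ℝ) • H q := by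
      filter_upwards [lt_mem_nhds (zero_lt_one (α := ℝ))] with t ht using hhom t ht
    simpa using h₁.unique (h₂.congr_of_eventuallyEq h₃)
  have hterm (k : Fin d) :
      fderiv ℝ (fun x : Fin d → ℝ => H x * (x k : ℂ)) q (Pi.single k 1)
        = H q + fderiv ℝ H q (q k • Pi.single k 1) := by
    have hk : HasFDerivAt (fun x : Fin d → ℝ => (x k : ℂ))
        (Complex.ofRealCLM.comp (ContinuousLinearMap.proj (φ := fun _ : Fin d => ℝ) k)) q :=
      (Complex.ofRealCLM.comp
        (ContinuousLinearMap.proj (R := ℝ) (φ := fun _ : Fin d => ℝ) k)).hasFDerivAt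
    rw [(hH.hasFDerivAt.fun_mul hk).fderiv]
    simp
  have hsum : ∑ k, q k • (Pi.single k 1 : Fin d → ℝ) = q := by
    simpa using (Pi.basisFun ℝ (Fin d)).sum_repr q
  simp_rw [hterm]
  rw [Finset.sum_add_distrib, ← map_sum, hsum, euler]
  simp

/-- Closedness `d(f ω) = 0` of the `(d-1)`-form `f ω` on the future lightcone
`C_d^+ = {P : P·P = 0, P₀ > 0} ⊂ ℝ^{d+1}`, for `f` smooth and homogeneous of degree
`-(d-1)`, where `ω = i_ξ μ`, `μ = dP₁∧…∧dP_d / P₀` and `ξ` is the Euler vector field.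
The cone has the global chart `q ↦ (|q|, q)`, `q ∈ ℝ^d \ {0}`, in which
`f ω = ∑_k (-1)^{k+1} f(|q|,q) (q_k/|q|) dq₁∧…∧dq̂_k∧…∧dq_d`, and `d(f ω) = 0` reads
`div_q ( f(|q|, q) · q/|q| ) = 0`, i.e. the sum over `k` of the partial derivatives in
direction `e_k` of the components `q ↦ f(|q|,q) q_k/|q|` vanishes. -/
theorem stmt_9 (d : ℕ) (hd : 2 ≤ d) (f : (Fin (d + 1) → ℝ) → ℂ)
    (hhom : ∀ (lam : ℝ), 0 < lam → ∀ P : Fin (d + 1) → ℝ,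
      (P 0) ^ 2 = (∑ i : Fin d, (P i.succ) ^ 2) → 0 < P 0 →
      f (lam • P) = ((lam ^ (d - 1))⁻¹ : ℝ) • f P)
    (hsmooth : ContDiffOn ℝ (⊤ : ℕ∞)
      (fun q : Fin d → ℝ => f (Fin.cons (Real.sqrt (∑ i, q i ^ 2)) q))
      {q : Fin d → ℝ | q ≠ 0}) :
    ∀ q : Fin d → ℝ, q ≠ 0 →
      (∑ k : Fin d,
        fderiv ℝ (fun q' : Fin d → ℝ =>
            f (Fin.cons (Real.sqrt (∑ i, q' i ^ 2)) q')
              * ((q' k : ℂ) / (Real.sqrt (∑ i, q' i ^ 2) : ℂ)))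
          q (Pi.single k 1)) = 0 := by
  intro q hq
  have hpos : 0 < ∑ i, q i ^ 2 := by
    obtain ⟨i, hi⟩ := Function.ne_iff.mp hq
    exact Finset.sum_pos' (fun i _ => sq_nonneg (q i)) ⟨i, Finset.mem_univ i, by
      have : q i ≠ 0 := hi
      positivity⟩
  have hF := (hsmooth.contDiffAt (isOpen_ne.mem_nhds hq)).differentiableAt (by simp)
  have hr : DifferentiableAt ℝ (fun x : Fin d → ℝ => ((Real.sqrt (∑ i, x i ^ 2) : ℝ) : ℂ)) q :=
    Complex.ofRealCLM.differentiableAt.comp q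
      (DifferentiableAt.sqrt (by fun_prop) hpos.ne')
  have hr0 : ((Real.sqrt (∑ i, q i ^ 2) : ℝ) : ℂ) ≠ 0 :=
    Complex.ofReal_ne_zero.mpr (Real.sqrt_pos.mpr hpos).ne'
  have key := sum_fderiv_mul_coord_eq_zero_of_homogeneous (hF.fun_mul (hr.fun_inv hr0)) ?_
  · simpa only [div_eq_mul_inv, mul_assoc, mul_comm,
      mul_left_comm] using key
  · intro t ht
    have hsqrt : Real.sqrt (∑ i, (t • q) i ^ 2) = t * Real.sqrt (∑ i, q i ^ 2) := by
      simp only [Pi.smul_apply, smul_eq_mul, mul_pow, ← Finset.mul_sum]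
      rw [Real.sqrt_mul (sq_nonneg t), Real.sqrt_sq ht.le]
    have hcons : (Fin.cons (t * Real.sqrt (∑ i, q i ^ 2)) (t • q) : Fin (d + 1) → ℝ)
        = t • (Fin.cons (Real.sqrt (∑ i, q i ^ 2)) q : Fin (d + 1) → ℝ) := by
      ext i
      refine Fin.cases ?_ (fun j => ?_) i <;> simp
    have hf := hhom t ht (Fin.cons (Real.sqrt (∑ i, q i ^ 2)) q)
      (by simpa using Real.sq_sqrt hpos.le) (by simpa using Real.sqrt_pos.mpr hpos)
    have htd : t ^ d = t ^ (d - 1) * t := (pow_sub_one_mul (by omega) t).symm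
    simp only [hsqrt, hcons, hf, htd, Complex.real_smul]
    push_cast
    rw [mul_inv, mul_inv]
    ring
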